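/- arXiv:0903.2357 — 2 statements merged into one kernel-verified Lean document; each statement's English description precedes it below -/
import Mathlib

section
/- Let g > 0, α ≠ 0, μ and c be real numbers, and let f : ℝ → ℝ be a twice differentiable function satisfying f''(u) + 2·f(u)³ = 0 for all u (the defining equation of the Jacobi snoidal function sn(·, i)). Define φ(t) = μ·g^{−1/2}·f(μ·g^{1/2}·t + c). Then the time-dependent SU(2) gauge field given by Smilga's choice built from φ satisfies the gauge-fixed SU(2) Yang–Mills field equations with coupling g and gauge parameter α, for every a ∈ {1,2,3} and ν ∈ {0,1,2,3}. -/
/-- Partial derivative along the `μ`-th coordinate of a function on ℝ⁴. -/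
noncomputable def pd (μ : Fin 4) (f : (Fin 4 → ℝ) → ℝ) (x : Fin 4 → ℝ) : ℝ :=
  fderiv ℝ f x (Pi.single μ 1)

/-- Minkowski metric diag(1, -1, -1, -1) (diagonal entries). -/
noncomputable def eta : Fin 4 → ℝ := fun μ => if μ = 0 then 1 else -1

/-- Levi-Civita symbol on three indices (structure constants of SU(2)). -/
noncomputable def eps (a b c : Fin 3) : ℝ :=
  (((b : ℕ) : ℝ) - ((a : ℕ) : ℝ)) * (((c : ℕ) : ℝ) - ((a : ℕ) : ℝ)) *
    (((c : ℕ) : ℝ) - ((b : ℕ) : ℝ)) / 2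

/-- Smilga's choice: `A_0^a = 0`, `A_k^a = δ_k^a φ` for spatial `k`. -/
noncomputable def smilga (φ : (Fin 4 → ℝ) → ℝ) (a : Fin 3) (ν : Fin 4)
    (x : Fin 4 → ℝ) : ℝ :=
  if ν = Fin.succ a then φ x else 0

/-- The left-hand side of the gauge-fixed SU(2) Yang-Mills field equations
with coupling `g` and gauge parameter `α`, for color `a` and spacetime index `ν`:
∂^μ∂_μ A_ν^a − (1 − 1/α) ∂_ν(∂^μ A_μ^a) + g ε_{abc} A^{bμ}(∂_μ A_ν^c − ∂_ν A_μ^c)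
 + g ε_{abc} ∂^μ(A_μ^b A_ν^c) + g² ε_{abc} ε_{cde} A^{bμ} A_μ^d A_ν^e. -/
noncomputable def ymLhs (g α : ℝ) (A : Fin 3 → Fin 4 → (Fin 4 → ℝ) → ℝ)
    (a : Fin 3) (ν : Fin 4) (x : Fin 4 → ℝ) : ℝ :=
  (∑ μ, eta μ * pd μ (pd μ (A a ν)) x)
  - (1 - 1 / α) * pd ν (fun y => ∑ μ, eta μ * pd μ (A a μ) y) x
  + g * ∑ b, ∑ c, eps a b c *
      ∑ μ, eta μ * A b μ x * (pd μ (A c ν) x - pd ν (A c μ) x)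
  + g * ∑ b, ∑ c, eps a b c *
      ∑ μ, eta μ * pd μ (fun y => A b μ y * A c ν y) x
  + g ^ 2 * ∑ b, ∑ c, ∑ d, ∑ e, eps a b c * eps c d e *
      (∑ μ, eta μ * A b μ x * A d μ x) * A e ν x

theorem pd_time (h : ℝ → ℝ) (hh : Differentiable ℝ h) (m : Fin 4) (x : Fin 4 → ℝ) :
    pd m (fun y => h (y 0)) x = if m = 0 then deriv h (x 0) else 0 := by
  have h1 : HasFDerivAt (fun y : Fin 4 → ℝ => y 0)
      (ContinuousLinearMap.proj (R := ℝ) (φ := fun _ : Fin 4 => ℝ) 0) x :=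
    hasFDerivAt_apply 0 x
  have h2 := (hh (x 0)).hasDerivAt.comp_hasFDerivAt x h1
  have h3 : HasFDerivAt (fun y : Fin 4 → ℝ => h (y 0)) _ x := h2
  unfold pd
  rw [h3.fderiv]
  fin_cases m <;> simp

theorem pd_smilga (h : ℝ → ℝ) (hh : Differentiable ℝ h) (m : Fin 4) (a : Fin 3) (n : Fin 4) :
    pd m (smilga (fun y => h (y 0)) a n) =
      fun x => if n = Fin.succ a ∧ m = 0 then deriv h (x 0) else 0 := by
  funext x
  by_cases hn : n = Fin.succ a
  · have : smilga (fun y => h (y 0)) a n = fun y => h (y 0) := by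
      funext y; simp [smilga, hn]
    rw [this, pd_time h hh]; simp [hn]
  · have : smilga (fun y => h (y 0)) a n = fun y => (fun _ : ℝ => (0:ℝ)) (y 0) := by
      funext y; simp [smilga, hn]
    rw [this]; rw [pd_time (fun _ : ℝ => (0:ℝ)) (by fun_prop)]; simp [hn]

theorem pd_zero (m : Fin 4) (x : Fin 4 → ℝ) : pd m (fun _ => (0:ℝ)) x = 0 := by
  simp [pd]

theorem ym_term1 (h : ℝ → ℝ) (hh : Differentiable ℝ h) (hh' : Differentiable ℝ (deriv h))
    (a : Fin 3) (n : Fin 4) (x : Fin 4 → ℝ) (m : Fin 4) :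
    pd m (pd m (smilga (fun y => h (y 0)) a n)) x =
      if n = Fin.succ a ∧ m = 0 then deriv (deriv h) (x 0) else 0 := by
  rw [pd_smilga h hh]
  by_cases hc : n = Fin.succ a ∧ m = 0
  · simp only [hc, and_self, if_true]
    rw [pd_time _ hh']; simp
  · simp only [hc, if_false]
    exact pd_zero m x

theorem ym_term4 (h : ℝ → ℝ) (hh : Differentiable ℝ h)
    (b c : Fin 3) (n : Fin 4) (x : Fin 4 → ℝ) (m : Fin 4) :
    pd m (fun y => smilga (fun y => h (y 0)) b m y * smilga (fun y => h (y 0)) c n y) x = 0 := by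
  by_cases hm : m = Fin.succ b
  · by_cases hn : n = Fin.succ c
    · have : (fun y => smilga (fun y => h (y 0)) b m y * smilga (fun y => h (y 0)) c n y)
          = fun y => (fun t => h t * h t) (y 0) := by
        funext y; simp [smilga, hm, hn]
      rw [this]; rw [pd_time (fun t => h t * h t) (by fun_prop)]
      simp [hm, Fin.succ_ne_zero]
    · simp only [smilga, hn, if_false, mul_zero]
      exact pd_zero m x
  · simp only [smilga, hm, if_false, zero_mul]
    exact pd_zero m x

theorem ym_reduce (g α : ℝ) (h : ℝ → ℝ) (hh : Differentiable ℝ h)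
    (hh' : Differentiable ℝ (deriv h))
    (hode : ∀ t, deriv (deriv h) t = - 2 * g ^ 2 * h t ^ 3) (a : Fin 3) (n : Fin 4)
    (x : Fin 4 → ℝ) : ymLhs g α (smilga (fun y => h (y 0))) a n x = 0 := by
  have h2 : (fun y => ∑ m, eta m * pd m (smilga (fun y => h (y 0)) a m) y) = fun _ => (0:ℝ) := by
    funext y
    apply Finset.sum_eq_zero
    intro m _
    rw [pd_smilga h hh]
    have : ¬ (m = Fin.succ a ∧ m = 0) := by
      rintro ⟨h1, h2⟩
      exact Fin.succ_ne_zero a (h1.symm.trans h2)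
    simp [this]
  have h3 : ∀ b c, eps a b c * ∑ m, eta m * smilga (fun y => h (y 0)) b m x *
      (pd m (smilga (fun y => h (y 0)) c n) x - pd n (smilga (fun y => h (y 0)) c m) x) = 0 := by
    intro b c
    by_cases hbc : b = c
    · subst hbc; simp [eps]
    · rw [Finset.sum_eq_zero, mul_zero]
      intro m _
      by_cases hm : m = Fin.succ b
      · subst hm
        simp [pd_smilga h hh, Fin.succ_ne_zero, hbc]
      · simp [smilga, hm]
  unfold ymLhs
  rw [h2, pd_zero]
  simp only [h3, ym_term4 h hh, ym_term1 h hh hh', hode]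
  have e5 : ∀ b d, (∑ m, eta m * smilga (fun y => h (y 0)) b m x * smilga (fun y => h (y 0)) d m x)
      = if b = d then - h (x 0) ^ 2 else 0 := by
    intro b d
    rw [Finset.sum_eq_single (Fin.succ b)]
    · by_cases hbd : b = d <;> simp [smilga, eta, hbd, Fin.succ_ne_zero]
      ring
    · intro m _ hm
      simp [smilga, hm]
    · simp
  simp only [e5]
  fin_cases a <;> fin_cases n <;>
    simp [Fin.sum_univ_succ, smilga, eta, eps] <;> norm_num [Fin.ext_iff] <;> ring_nf

/-- with `f'' + 2 f³ = 0` (the ODE of the Jacobi snoidal function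
`sn(·, i)`) and `φ(t) = μ g^{-1/2} f(μ g^{1/2} t + c)`, the Smilga configuration
built from `x ↦ φ(x⁰)` solves the gauge-fixed SU(2) Yang-Mills equations. -/
theorem smilga_snoidal_solves_yangMills
    (g α μ c : ℝ) (hg : 0 < g) (hα : α ≠ 0)
    (f : ℝ → ℝ) (hf : Differentiable ℝ f) (hf' : Differentiable ℝ (deriv f))
    (hode : ∀ u : ℝ, deriv (deriv f) u + 2 * (f u) ^ 3 = 0)
    (φ : ℝ → ℝ)
    (hφ : ∀ t : ℝ, φ t = μ * g ^ (-(1 : ℝ) / 2) * f (μ * g ^ ((1 : ℝ) / 2) * t + c)) :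
    ∀ (a : Fin 3) (ν : Fin 4) (x : Fin 4 → ℝ),
      ymLhs g α (smilga (fun y => φ (y 0))) a ν x = 0 := by
  have hd : φ = fun t => μ * g ^ (-(1 : ℝ) / 2) * f (μ * g ^ ((1 : ℝ) / 2) * t + c) := funext hφ
  set s := g ^ ((1 : ℝ) / 2) with hs
  set r := g ^ (-(1 : ℝ) / 2) with hr
  have hss : s * s = g := by
    rw [hs, ← Real.rpow_add hg]; norm_num
  have hrs : r * s = 1 := by
    rw [hs, hr, ← Real.rpow_add hg]; norm_num
  have key : ∀ (k : ℝ) (F : ℝ → ℝ), Differentiable ℝ F → ∀ t,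
      HasDerivAt (fun t => k * F (μ * s * t + c)) (k * (μ * s) * deriv F (μ * s * t + c)) t := by
    intro k F hF t
    have h1 : HasDerivAt (fun t => μ * s * t + c) (μ * s) t := by
      simpa using ((hasDerivAt_id t).const_mul (μ * s)).add_const c
    have h2 := ((hF (μ * s * t + c)).hasDerivAt.comp t h1).const_mul k
    exact HasDerivAt.congr_deriv (f := fun t => k * F (μ * s * t + c)) h2 (by ring)
  have d1 : deriv φ = fun t => μ * r * (μ * s) * deriv f (μ * s * t + c) := by
    funext t; rw [hd]; exact (key _ f hf t).deriv
  apply ym_reduce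
  · rw [hd]; exact fun t => (key _ f hf t).differentiableAt
  · rw [d1]; exact fun t => (key _ _ hf' t).differentiableAt
  · intro t
    rw [d1, (key _ _ hf' t).deriv, hφ]
    have := hode (μ * s * t + c)
    have e : deriv (deriv f) (μ * s * t + c) = - 2 * f (μ * s * t + c) ^ 3 := by linarith
    rw [e, ← hss]
    generalize f (μ * s * t + c) = z
    have e2 : r * s * s = s := by rw [hrs, one_mul]
    have e3 : (s * s) ^ 2 * r ^ 3 = s := by
      calc (s * s) ^ 2 * r ^ 3 = (r * s) ^ 3 * s := by ring
        _ = s := by rw [hrs]; ring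
    linear_combination (-2 * μ ^ 3 * z ^ 3) * e2 + (2 * μ ^ 3 * z ^ 3) * e3
end

section
/- Let φ : ℝ⁴ → ℝ be differentiable and let A_ν^a be the field configuration of Smilga's choice built from φ. Then the terms of the Yang–Mills field equations that are cubic in the field (linear in g) evaluate, for each a ∈ {1,2,3}, to: ε_{abc} A^{bμ}(∂_μ A_ν^c − ∂_ν A_μ^c) + ε_{abc} ∂^μ(A_μ^b A_ν^c) = −3·Σ_{b=1}^{3} ε_{abν}·φ·∂_b φ when ν ∈ {1,2,3}, and = 0 when ν = 0 (all color sums explicit, spacetime indices raised with η = diag(1,−1,−1,−1)). In particular these cubic terms vanish identically whenever φ depends only on the time variable x⁰. -/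
/-- The terms of the Yang-Mills field equations cubic in the field (linear in
the coupling): `ε_{abc} A^{bμ}(∂_μ A_ν^c − ∂_ν A_μ^c) + ε_{abc} ∂^μ(A_μ^b A_ν^c)`. -/
noncomputable def cubicTerms (A : Fin 3 → Fin 4 → (Fin 4 → ℝ) → ℝ)
    (a : Fin 3) (ν : Fin 4) (x : Fin 4 → ℝ) : ℝ :=
  (∑ b, ∑ c, eps a b c *
      ∑ μ, eta μ * A b μ x * (pd μ (A c ν) x - pd ν (A c μ) x))
  + ∑ b, ∑ c, eps a b c * ∑ μ, eta μ * pd μ (fun y => A b μ y * A c ν y) x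

theorem pd_smilga_s9 (φ : (Fin 4 → ℝ) → ℝ) (c : Fin 3) (μ ν : Fin 4) (x : Fin 4 → ℝ) :
    pd μ (smilga φ c ν) x = if ν = Fin.succ c then pd μ φ x else 0 := by
  have : smilga φ c ν = if ν = Fin.succ c then φ else fun _ => 0 := by
    funext y; unfold smilga; split_ifs <;> rfl
  rw [this]
  split_ifs <;> simp [pd]

theorem pd_smilga_mul (φ : (Fin 4 → ℝ) → ℝ) (hφ : Differentiable ℝ φ) (b c : Fin 3)
    (μ κ ν : Fin 4) (x : Fin 4 → ℝ) :
    pd μ (fun y => smilga φ b κ y * smilga φ c ν y) x =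
      if κ = Fin.succ b then (if ν = Fin.succ c then 2 * φ x * pd μ φ x else 0) else 0 := by
  unfold smilga
  split_ifs
  · unfold pd
    rw [fderiv_fun_mul (hφ x) (hφ x)]
    simp
    ring
  all_goals simp [pd]

theorem cubic_space (φ : (Fin 4 → ℝ) → ℝ) (hφ : Differentiable ℝ φ) (a k : Fin 3)
    (x : Fin 4 → ℝ) : cubicTerms (smilga φ) a (Fin.succ k) x
      = -3 * ∑ b, eps a b k * φ x * pd (Fin.succ b) φ x := by
  have e (b : Fin 3) : eps a b b = 0 := by simp [eps]
  have t (b : Fin 3) : eta (Fin.succ b) = -1 := by simp [eta]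
  have h0 (b c : Fin 3) : (if b = c then eps a b c else 0) = 0 := by
    split_ifs with h
    · rw [h, e]
    · rfl
  unfold cubicTerms
  simp only [pd_smilga_s9, pd_smilga_mul φ hφ]
  simp only [smilga, Fin.sum_univ_succ (n := 3), t, Fin.succ_inj]
  fin_cases k <;> simp [Fin.sum_univ_three, e] <;> ring

theorem cubic_time (φ : (Fin 4 → ℝ) → ℝ) (hφ : Differentiable ℝ φ) (a : Fin 3)
    (x : Fin 4 → ℝ) : cubicTerms (smilga φ) a 0 x = 0 := by
  have e (b : Fin 3) : eps a b b = 0 := by simp [eps]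
  unfold cubicTerms
  simp only [pd_smilga_s9, pd_smilga_mul φ hφ]
  simp only [smilga, Fin.sum_univ_succ (n := 3), Fin.succ_inj]
  simp [Fin.sum_univ_three, e]

theorem pd_time_s9 (φ : (Fin 4 → ℝ) → ℝ) (hφ : Differentiable ℝ φ)
    (h : ∀ y y' : Fin 4 → ℝ, y 0 = y' 0 → φ y = φ y') (b : Fin 3) (x : Fin 4 → ℝ) :
    pd (Fin.succ b) φ x = 0 := by
  unfold pd
  rw [← (hφ x).lineDeriv_eq_fderiv]
  unfold lineDeriv
  have : (fun t : ℝ => φ (x + t • Pi.single (Fin.succ b) 1)) = fun _ => φ x := by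
    funext t
    apply h
    simp [(Fin.succ_ne_zero b).symm]
  rw [this]
  simp

/-- on Smilga's choice the cubic terms of the Yang-Mills field
equations evaluate to `−3 Σ_b ε_{abν} φ ∂_b φ` for spatial `ν` and vanish for
`ν = 0`; in particular they vanish identically when `φ` depends only on time. -/
theorem smilga_cubic_terms (φ : (Fin 4 → ℝ) → ℝ) (hφ : Differentiable ℝ φ) :
    ∀ (a : Fin 3) (x : Fin 4 → ℝ),
      (∀ k : Fin 3,
        cubicTerms (smilga φ) a (Fin.succ k) x
          = -3 * ∑ b, eps a b k * φ x * pd (Fin.succ b) φ x)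
      ∧ cubicTerms (smilga φ) a 0 x = 0
      ∧ ((∀ y y' : Fin 4 → ℝ, y 0 = y' 0 → φ y = φ y') →
          ∀ ν : Fin 4, cubicTerms (smilga φ) a ν x = 0) := by
  intro a x
  refine ⟨fun k => cubic_space φ hφ a k x, cubic_time φ hφ a x, fun h ν => ?_⟩
  refine Fin.cases (cubic_time φ hφ a x) (fun k => ?_) ν
  rw [cubic_space φ hφ]
  simp [pd_time_s9 φ hφ h]
end
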